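/- Let T be a tree and let S be a connected component of the subgraph of T induced by the closed neighborhood N[Supp(T)], regarded as a tree in its own right. Then: (a) if x ∈ ℝ^{V(T)} lies in the null space of A(T), the restriction of x to V(S) lies in the null space of A(S); and (b) if y ∈ ℝ^{V(S)} lies in the null space of A(S), then the extension of y to ℝ^{V(T)} by zero on V(T) \ V(S) lies in the null space of A(T). -/

import Mathlib

open scoped Classical

namespace NullDecomp

variable {V : Type*}

/-- The null space of the real adjacency matrix of a graph. -/
def nullSpace [Fintype V] (G : SimpleGraph V) : Set (V → ℝ) :=
  {x | Matrix.mulVec (G.adjMatrix ℝ) x = 0}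

/-- The support of the null space: vertices with a nonzero entry in some null vector. -/
def supportSet [Fintype V] (G : SimpleGraph V) : Set V :=
  {v | ∃ x ∈ nullSpace G, x v ≠ 0}

/-- The (open) neighborhood of a set of vertices. -/
def nbhdSet (G : SimpleGraph V) (A : Set V) : Set V :=
  {v | ∃ u ∈ A, G.Adj u v}

/-- The closed neighborhood of a set of vertices. -/
def closedNbhd (G : SimpleGraph V) (A : Set V) : Set V :=
  A ∪ nbhdSet G A

/-- The core of a graph: the neighborhood of the support of the null space. -/
def coreSet [Fintype V] (G : SimpleGraph V) : Set V :=
  nbhdSet G (supportSet G)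

/-- A tree is an S-tree if the closed neighborhood of its support is everything. -/
def IsSTree [Fintype V] (G : SimpleGraph V) : Prop :=
  G.IsTree ∧ closedNbhd G (supportSet G) = Set.univ

/-- A matching: a set of edges of `G`, pairwise disjoint. -/
def IsMatchingSet (G : SimpleGraph V) (M : Finset (Sym2 V)) : Prop :=
  (↑M : Set (Sym2 V)) ⊆ G.edgeSet ∧
    ∀ e ∈ M, ∀ f ∈ M, e ≠ f → ∀ v : V, v ∈ e → v ∉ f

/-- A maximum matching. -/
def IsMaxMatching [Fintype V] (G : SimpleGraph V) (M : Finset (Sym2 V)) : Prop :=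
  IsMatchingSet G M ∧ ∀ M' : Finset (Sym2 V), IsMatchingSet G M' → M'.card ≤ M.card

/-- The matching number. -/
noncomputable def matchingNumber [Fintype V] (G : SimpleGraph V) : ℕ :=
  sSup {n | ∃ M : Finset (Sym2 V), IsMatchingSet G M ∧ M.card = n}

/-- An independent set of vertices. -/
def IsIndep (G : SimpleGraph V) (A : Set V) : Prop :=
  ∀ u ∈ A, ∀ w ∈ A, ¬ G.Adj u w

/-- The independence number. -/
noncomputable def indepNumber [Fintype V] (G : SimpleGraph V) : ℕ :=
  sSup {n | ∃ A : Set V, IsIndep G A ∧ A.ncard = n}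

/-- A vertex cover. -/
def IsVertexCover (G : SimpleGraph V) (Cs : Set V) : Prop :=
  ∀ e ∈ G.edgeSet, ∃ v ∈ Cs, v ∈ e

/-- The vertex cover number. -/
noncomputable def coverNumber [Fintype V] (G : SimpleGraph V) : ℕ :=
  sInf {n | ∃ Cs : Set V, IsVertexCover G Cs ∧ Cs.ncard = n}

/-- The nullity of a graph: dimension of the kernel of its adjacency matrix. -/
noncomputable def nullity [Fintype V] (G : SimpleGraph V) : ℕ :=
  Module.finrank ℝ (LinearMap.ker (Matrix.mulVecLin (G.adjMatrix ℝ)))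

/-- The number of maximum matchings of a graph. -/
noncomputable def numMaxMatchings [Fintype V] (G : SimpleGraph V) : ℕ :=
  Set.ncard {M : Finset (Sym2 V) | IsMaxMatching G M}

/-- `C` is (the vertex set of) a connected component of the subgraph of `T`
induced by the closed neighborhood of the support of `T`. -/
def IsSComponent [Fintype V] (T : SimpleGraph V) (C : Set V) : Prop :=
  ∃ c : (T.induce (closedNbhd T (supportSet T))).ConnectedComponent,
    C = Subtype.val '' c.supp

/-- `C` is (the vertex set of) a connected component of the subgraph of `T`
induced by the complement of the closed neighborhood of the support of `T`. -/
def IsNComponent [Fintype V] (T : SimpleGraph V) (C : Set V) : Prop :=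
  ∃ c : (T.induce ((closedNbhd T (supportSet T))ᶜ)).ConnectedComponent,
    C = Subtype.val '' c.supp

/-- The zero-extension to `ℝ^V` of the null space of the subgraph of `T` induced by `C`:
vectors vanishing outside `C` whose restriction to `C` is a null vector of `T.induce C`. -/
noncomputable def extNull [Fintype V] (T : SimpleGraph V) (C : Set V) : Submodule ℝ (V → ℝ) :=
  LinearMap.ker ((Matrix.mulVecLin ((T.induce C).adjMatrix ℝ)).comp
      (LinearMap.funLeft ℝ ℝ (Subtype.val : ↥C → V))) ⊓
  LinearMap.ker (LinearMap.funLeft ℝ ℝ (Subtype.val : ↥(Cᶜ) → V))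

theorem mem_nullSpace_iff [Fintype V] {G : SimpleGraph V} {x : V → ℝ} :
    x ∈ nullSpace G ↔ ∀ v, ∑ w, (if G.Adj v w then x w else 0) = 0 := by
  simp only [nullSpace, Set.mem_ofPred_eq, funext_iff, Matrix.mulVec, dotProduct,
    SimpleGraph.adjMatrix_apply, ite_mul, one_mul, zero_mul, Pi.zero_apply]

/-- In a forest, a product of entries of null vectors at adjacent vertices vanishes. -/
theorem mul_eq_zero_of_adj [Fintype V] {G : SimpleGraph V} (hG : G.IsAcyclic) {x y : V → ℝ}
    (hx : x ∈ nullSpace G) (hy : y ∈ nullSpace G) {u v : V} (huv : G.Adj u v) :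
    x u * y v = 0 := by
  rw [mem_nullSpace_iff] at hx hy
  obtain ⟨c⟩ := hG.colorable_two
  set H := G.deleteEdges {s(u, v)} with hH
  have hbridge : ¬ H.Reachable u v :=
    SimpleGraph.isBridge_iff.1 (SimpleGraph.isAcyclic_iff_forall_adj_isBridge.1 hG huv)
  have step {a b : V} (hab : G.Adj a b) (hne : s(a, b) ≠ s(u, v)) (ha : H.Reachable u a) :
      H.Reachable u b :=
    ha.trans (SimpleGraph.Adj.reachable (by simpa [hH, SimpleGraph.deleteEdges_adj, hab] using hne))
  -- the color class of `u` within its component after deleting the edge `s(u, v)`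
  let W : Set V := {w | H.Reachable u w ∧ c w = c u}
  have hcolor {a b d : V} (h₁ : G.Adj a b) (h₂ : G.Adj a d) : c b = c d := by
    have := c.valid h₁
    have := c.valid h₂
    omega
  let z : V → ℝ := fun w => if w ∈ W then x w else 0
  have hz_ne {b : V} (hb : b ≠ v) : ∑ w, (if G.Adj b w then z w else 0) = 0 := by
    by_cases h : ∃ w, G.Adj b w ∧ w ∈ W
    · obtain ⟨w, hbw, hwu, hwc⟩ := h
      have hbu : b ≠ u := by
        rintro rfl
        exact c.valid hbw hwc.symm
      have hub : H.Reachable u b := step hbw.symm (by simp [hb, hbu]) hwu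
      refine Eq.trans ?_ (hx b)
      refine Finset.sum_congr rfl fun w' _ => ?_
      split_ifs with hbw'
      · exact if_pos ⟨step hbw' (by simp [hb, hbu]) hub, (hcolor hbw' hbw).trans hwc⟩
      · rfl
    · push Not at h
      refine Finset.sum_eq_zero fun w _ => ?_
      split_ifs with hbw
      · exact if_neg (h w hbw)
      · rfl
  have hz_v : ∑ w, (if G.Adj v w then z w else 0) = x u := by
    rw [Finset.sum_eq_single u]
    · rw [if_pos huv.symm]
      exact if_pos ⟨.rfl, rfl⟩
    · intro w _ hwu
      split_ifs with hvw
      · refine if_neg fun hw => hbridge (step hvw.symm ?_ hw.1)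
        simp [hwu, hvw.ne']
      · rfl
    · simp
  have hsum : ∑ b, (∑ w, (if G.Adj b w then z w else 0)) * y b = x u * y v := by
    rw [Finset.sum_eq_single v (fun b _ hb => by rw [hz_ne hb, zero_mul]) (by simp), hz_v]
  rw [← hsum]
  simp_rw [Finset.sum_mul]
  rw [Finset.sum_comm]
  refine Finset.sum_eq_zero fun w _ => ?_
  calc ∑ b, (if G.Adj b w then z w else 0) * y b
      = z w * ∑ b, (if G.Adj w b then y b else 0) := by
        rw [Finset.mul_sum]
        refine Finset.sum_congr rfl fun b _ => ?_
        simp [G.adj_comm w b]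
    _ = 0 := by rw [hy w, mul_zero]

theorem IsSComponent.subset [Fintype V] {T : SimpleGraph V} {C : Set V} (hC : IsSComponent T C) :
    C ⊆ closedNbhd T (supportSet T) := by
  obtain ⟨c, rfl⟩ := hC
  rintro _ ⟨v, _, rfl⟩
  exact v.2

theorem IsSComponent.mem_of_adj [Fintype V] {T : SimpleGraph V} {C : Set V}
    (hC : IsSComponent T C) {v w : V} (hv : v ∈ C) (hvw : T.Adj v w)
    (hw : w ∈ closedNbhd T (supportSet T)) : w ∈ C := by
  obtain ⟨c, rfl⟩ := hC
  obtain ⟨v, hv, rfl⟩ := hv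
  exact ⟨⟨w, hw⟩, c.mem_supp_of_adj_mem_supp hv (by simpa using hvw), rfl⟩

theorem sum_induce_adj [Fintype V] (T : SimpleGraph V) (C : Set V) (f : V → ℝ)
    (hf : ∀ w ∉ C, f w = 0) (v : V) :
    ∑ w, (if T.Adj v w then f w else 0) = ∑ w : C, (if T.Adj v w then f w else 0) := by
  rw [← Finset.sum_subtype (Finset.univ.filter (· ∈ C)) (by simp)
    (fun w => if T.Adj v w then f w else 0), Finset.sum_filter]
  refine Finset.sum_congr rfl fun w _ => ?_
  by_cases hw : w ∈ C <;> simp [hw, hf]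

theorem restrict_mem_nullSpace [Fintype V] {T : SimpleGraph V} {C : Set V}
    (hC : IsSComponent T C) {x : V → ℝ} (hx : x ∈ nullSpace T) :
    (fun v : ↥C => x ↑v) ∈ nullSpace (T.induce C) := by
  have hx' := mem_nullSpace_iff.1 hx
  refine mem_nullSpace_iff.2 fun v => ?_
  refine Eq.trans ?_ (hx' v)
  have h := sum_induce_adj T C (fun w => if w ∈ C then x w else 0) (fun w hw => if_neg hw) v
  simp only [Subtype.coe_prop, if_true] at h
  simp only [SimpleGraph.comap_adj, Function.Embedding.subtype_apply]
  refine h.symm.trans (Finset.sum_congr rfl fun w _ => ?_)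
  split_ifs with hvw hw
  · rfl
  · by_contra hne
    exact hw (hC.mem_of_adj v.2 hvw (Or.inl ⟨x, hx, Ne.symm hne⟩))
  · rfl

/-- Null vectors of an S-component of a forest vanish off the support of the forest. -/
theorem eq_zero_of_notMem_supportSet [Fintype V] {T : SimpleGraph V} (hT : T.IsAcyclic)
    {C : Set V} (hC : IsSComponent T C) {y : ↥C → ℝ} (hy : y ∈ nullSpace (T.induce C))
    {v : ↥C} (hv : (v : V) ∉ supportSet T) : y v = 0 := by
  obtain ⟨u, ⟨x, hx, hxu⟩, huv⟩ := (hC.subset v.2).resolve_left hv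
  have huC : u ∈ C := hC.mem_of_adj v.2 huv.symm (Or.inl ⟨x, hx, hxu⟩)
  have h := mul_eq_zero_of_adj (hT.induce C) (restrict_mem_nullSpace hC hx) hy
    (u := ⟨u, huC⟩) (v := v) (by simpa using huv)
  exact (mul_eq_zero.1 h).resolve_left hxu

/-- For a connected component `S = T.induce C` of the subgraph of a tree `T` induced by
`N[Supp(T)]`: (a) restrictions of null vectors of `T` are null vectors of `S`;
(b) zero-extensions of null vectors of `S` are null vectors of `T`. -/
theorem stmt14 [Fintype V] (T : SimpleGraph V) (hT : T.IsTree)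
    (C : Set V) (hC : IsSComponent T C) :
    (∀ x ∈ nullSpace T, (fun v : ↥C => x ↑v) ∈ nullSpace (T.induce C)) ∧
      (∀ y ∈ nullSpace (T.induce C),
        (fun v : V => if h : v ∈ C then y ⟨v, h⟩ else 0) ∈ nullSpace T) := by
  refine ⟨fun x hx => restrict_mem_nullSpace hC hx, fun y hy => mem_nullSpace_iff.2 fun v => ?_⟩
  have hy' := mem_nullSpace_iff.1 hy
  rw [sum_induce_adj T C _ (fun w hw => dif_neg hw) v]
  simp only [Subtype.coe_prop, dite_true, Subtype.coe_eta]
  by_cases hv : v ∈ C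
  · simpa using hy' ⟨v, hv⟩
  · refine Finset.sum_eq_zero fun w _ => ?_
    split_ifs with hvw
    · refine eq_zero_of_notMem_supportSet hT.isAcyclic hC hy fun hw => hv ?_
      exact hC.mem_of_adj w.2 hvw.symm (Or.inr ⟨w, hw, hvw.symm⟩)
    · rfl

end NullDecomp
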